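/- (Proposition 3, inequality (23)) Let d ≥ 2, n = d+1, and fix nonnegative integers ℓ₁, ℓ₂ with ℓ := ℓ₁+ℓ₂ < d. For any symmetrical code that satisfies node regeneration, message recovery (for parameter ℓ), and repair secrecy (for parameters ℓ₁, ℓ₂), one has H(U^{(ℓ₁+1,ℓ+1)}) + (T_{d,d,ℓ+1}/(d−ℓ)) · H(U^{(ℓ₁,ℓ+1)}) ≥ T_{d,d,ℓ} · Σ_{j=ℓ+1}^{d} T_{d,j,ℓ}^{−1} B_j + (T_{d,d,ℓ}/(d−ℓ)) · H(U^{(ℓ₁,ℓ)}). -/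

import Mathlib

open scoped BigOperators Classical

namespace MDCSR

noncomputable section

/-- `X` is a deterministic function of `Y`. -/
def IsFuncOf {Ω α β : Type*} (X : Ω → α) (Y : Ω → β) : Prop :=
  ∃ f : β → α, ∀ ω, X ω = f (Y ω)

variable {Ω V : Type} [Fintype Ω]

/-- Probability of the event `X = x` under the probability mass function `p`. -/
def pm (p : Ω → ℝ) {α : Type*} (X : Ω → α) (x : α) : ℝ :=
  ∑ ω ∈ Finset.univ.filter (fun ω' => X ω' = x), p ω

/-- Shannon entropy of the random variable `X` under the probability mass function `p`. -/
def H (p : Ω → ℝ) {α : Type*} (X : Ω → α) : ℝ :=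
  -∑ ω, p ω * Real.log (pm p X (X ω))

/-- An `(n = d+1, d)` code: messages `M 1, …, M d`, a key `K`, node contents
`W 1, …, W (d+1)`, and repair data `S i j` (data downloaded from node `i` to repair
node `j`), all random variables on a common finite probability space `(Ω, p)`.
The messages are mutually independent, the key is independent of the messages,
each `W i` is a deterministic function of the messages and the key, and each
`S i j` is a deterministic function of `W i`. -/
structure Code (Ω V : Type) [Fintype Ω] (d : ℕ) : Type where
  p : Ω → ℝ
  p_nonneg : ∀ ω, 0 ≤ p ω
  p_sum : ∑ ω, p ω = 1
  M : ℕ → Ω → V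
  K : Ω → V
  W : ℕ → Ω → V
  S : ℕ → ℕ → Ω → V
  M_indep : ∀ x : ℕ → V,
    pm p (fun ω (i : Fin d) => M (↑i + 1) ω) (fun i => x (↑i + 1)) =
      ∏ i ∈ Finset.Icc 1 d, pm p (M i) (x i)
  K_indep : ∀ (k : V) (x : ℕ → V),
    pm p (fun ω => (K ω, fun (i : Fin d) => M (↑i + 1) ω)) (k, fun i => x (↑i + 1)) =
      pm p K k * pm p (fun ω (i : Fin d) => M (↑i + 1) ω) (fun i => x (↑i + 1))
  W_func : ∀ i ∈ Finset.Icc 1 (d + 1),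
    IsFuncOf (W i) (fun ω => ((fun (j : Fin d) => M (↑j + 1) ω), K ω))
  S_func : ∀ i ∈ Finset.Icc 1 (d + 1), ∀ j ∈ Finset.Icc 1 (d + 1), i ≠ j →
    IsFuncOf (S i j) (W i)

/-- Descriptors for the basic random variables of a code. -/
inductive Atom where
  | M : ℕ → Atom
  | K : Atom
  | W : ℕ → Atom
  | S : ℕ → ℕ → Atom

variable {d : ℕ}

/-- The random variable described by an atom. -/
def Code.atomRV (C : Code Ω V d) : Atom → Ω → V
  | .M i => C.M i
  | .K => C.K
  | .W i => C.W i
  | .S i j => C.S i j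

/-- The joint random variable (tuple) described by a list of atoms. -/
def Code.rv (C : Code Ω V d) (L : List Atom) : Ω → List V :=
  fun ω => L.map fun a => C.atomRV a ω

/-- Joint entropy of a tuple of basic random variables. -/
def Code.HL (C : Code Ω V d) (L : List Atom) : ℝ := H C.p (C.rv L)

/-- Conditional entropy `H(L₁ | L₂)`. -/
def Code.CH (C : Code Ω V d) (L₁ L₂ : List Atom) : ℝ := C.HL (L₁ ++ L₂) - C.HL L₂

/-- Mutual information `I(L₁ ; L₂)`. -/
def Code.MI (C : Code Ω V d) (L₁ L₂ : List Atom) : ℝ :=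
  C.HL L₁ + C.HL L₂ - C.HL (L₁ ++ L₂)

/-- Relabeling of an atom along a permutation of the storage-node indices. -/
def Atom.perm (π : Equiv.Perm ℕ) : Atom → Atom
  | .M i => .M i
  | .K => .K
  | .W i => .W (π i)
  | .S i j => .S (π i) (π j)

/-- A code is symmetrical if every joint entropy of a tuple of the basic random
variables is invariant under every permutation of the storage-node indices `[1:n]`. -/
def Code.Symmetrical (C : Code Ω V d) : Prop :=
  ∀ π : Equiv.Perm ℕ, (∀ i ∈ Finset.Icc 1 (d + 1), π i ∈ Finset.Icc 1 (d + 1)) →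
    ∀ L : List Atom, C.HL (L.map (Atom.perm π)) = C.HL L

/-- The list `[a, a+1, …, b]`. -/
def icc (a b : ℕ) : List ℕ := List.range' a (b + 1 - a)

/-- `W_A` as a list of atoms. -/
def Ws (A : List ℕ) : List Atom := A.map Atom.W

/-- `M_A` as a list of atoms. -/
def MsL (A : List ℕ) : List Atom := A.map Atom.M

/-- `M^{(m)} = (M_1, …, M_m)`. -/
def Mup (m : ℕ) : List Atom := MsL (icc 1 m)

/-- `S_{B → j}`. -/
def Sto (B : List ℕ) (j : ℕ) : List Atom := B.map fun i => Atom.S i j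

/-- `S_{i → B}`. -/
def Sfrom (i : ℕ) (B : List ℕ) : List Atom := B.map fun j => Atom.S i j

/-- `S̄_{→ j} = S_{[j+1:n] → j}` (here `n = d+1`). -/
def SbarTo (d j : ℕ) : List Atom := Sto (icc (j + 1) (d + 1)) j

/-- `S̄_{→ A}`. -/
def SbarToL (d : ℕ) (A : List ℕ) : List Atom := (A.map (SbarTo d)).flatten

/-- `S̲_{→ j} = S_{[1:j-1] → j}`. -/
def SunderTo (j : ℕ) : List Atom := Sto (icc 1 (j - 1)) j

/-- `S̲_{→ A}`. -/
def SunderToL (A : List ℕ) : List Atom := (A.map SunderTo).flatten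

/-- `S_{→ j} = S_{([1:n] ∖ {j}) → j}` (here `n = d+1`). -/
def StoFull (d j : ℕ) : List Atom := Sto ((icc 1 (d + 1)).filter (fun i => i ≠ j)) j

/-- `(S_{→ j} : j ∈ A)`. -/
def StoFullL (d : ℕ) (A : List ℕ) : List Atom := (A.map (StoFull d)).flatten

/-- `U^{(t,s)} = (W_{[1:t]}, S̄_{→[t+1:s]})`. -/
def U (d t s : ℕ) : List Atom := Ws (icc 1 t) ++ SbarToL d (icc (t + 1) s)

/-- Node regeneration: each `W j` is a deterministic function of `S_{→ j}`. -/
def Code.NodeRegen (C : Code Ω V d) : Prop :=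
  ∀ j ∈ Finset.Icc 1 (d + 1), IsFuncOf (C.W j) (C.rv (StoFull d j))

/-- Message recovery for parameter `ℓ`: `M j` is constant for `j ∈ [1:ℓ]`, and for every
`A ⊆ [1:n]` with `|A| ∈ [ℓ+1:d]`, `M_{|A|}` is a deterministic function of `W_A`. -/
def Code.MsgRecovery (C : Code Ω V d) (ℓ : ℕ) : Prop :=
  (∀ j ∈ Finset.Icc 1 ℓ, ∃ c : V, ∀ ω, C.M j ω = c) ∧
  ∀ A : Finset ℕ, A ⊆ Finset.Icc 1 (d + 1) → A.card ∈ Finset.Icc (ℓ + 1) d →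
    IsFuncOf (C.M A.card) (C.rv (Ws (A.sort (· ≤ ·))))

/-- Repair secrecy for parameters `ℓ₁, ℓ₂`: for all disjoint `E₁, E₂ ⊆ [1:n]` with
`|E₁| = ℓ₁`, `|E₂| = ℓ₂`, the messages `M_{ℓ+1}, …, M_d` are independent of
`((W_i : i ∈ E₁), (S_{→j} : j ∈ E₂))`, where `ℓ = ℓ₁ + ℓ₂`. -/
def Code.RepairSecrecy (C : Code Ω V d) (ℓ₁ ℓ₂ : ℕ) : Prop :=
  ∀ E₁ E₂ : Finset ℕ, E₁ ⊆ Finset.Icc 1 (d + 1) → E₂ ⊆ Finset.Icc 1 (d + 1) →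
    Disjoint E₁ E₂ → E₁.card = ℓ₁ → E₂.card = ℓ₂ →
    C.MI (MsL (icc (ℓ₁ + ℓ₂ + 1) d))
      (Ws (E₁.sort (· ≤ ·)) ++ StoFullL d (E₂.sort (· ≤ ·))) = 0

/-- `T_{d,k,ℓ} = Σ_{t=ℓ+1}^{k} (d+1−t)`, as a real number. -/
def T (d k ℓ : ℕ) : ℝ := ∑ t ∈ Finset.Icc (ℓ + 1) k, ((d : ℝ) + 1 - (t : ℝ))


theorem pm_eq_sum_ite (p : Ω → ℝ) {α : Type*} (X : Ω → α) (x : α) :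
    pm p X x = ∑ ω, if X ω = x then p ω else 0 := by
  rw [pm, Finset.sum_filter]

section Entropy

variable {p : Ω → ℝ}

theorem pm_nonneg (hp : ∀ ω, 0 ≤ p ω) {α : Type*} (X : Ω → α) (x : α) : 0 ≤ pm p X x :=
  Finset.sum_nonneg fun ω _ => hp ω

theorem le_pm (hp : ∀ ω, 0 ≤ p ω) {α : Type*} (X : Ω → α) (ω : Ω) : p ω ≤ pm p X (X ω) :=
  Finset.single_le_sum (f := p) (fun ω _ => hp ω) (by simp)

/-- A random variable has at most the entropy of any random variable determining it. -/
theorem H_le_of_ker_le (hp : ∀ ω, 0 ≤ p ω) {α β : Type*} {X : Ω → α} {Y : Ω → β}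
    (h : ∀ ω ω', Y ω = Y ω' → X ω = X ω') : H p X ≤ H p Y := by
  refine neg_le_neg (Finset.sum_le_sum fun ω _ => ?_)
  rcases (hp ω).eq_or_lt with h0 | h0
  · simp [← h0]
  · refine mul_le_mul_of_nonneg_left (Real.log_le_log (h0.trans_le (le_pm hp Y ω)) ?_) h0.le
    refine Finset.sum_le_sum_of_subset_of_nonneg (fun a ha => ?_) fun a _ _ => hp a
    simp only [Finset.mem_filter, Finset.mem_univ, true_and] at ha ⊢
    exact h _ _ ha

theorem sum_mul_pm_ratio_le_one (hp : ∀ ω, 0 ≤ p ω) (hs : ∑ ω, p ω = 1) {α β γ : Type*}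
    {X : Ω → α} {Y : Ω → β} {Z : Ω → γ}
    (hX : ∀ ω ω', X ω = X ω' → Z ω = Z ω') (hY : ∀ ω ω', Y ω = Y ω' → Z ω = Z ω') :
    ∑ ω, p ω * (pm p X (X ω) * pm p Y (Y ω) /
      (pm p (fun ω => (X ω, Y ω)) (X ω, Y ω) * pm p Z (Z ω))) ≤ 1 := by
  set q : Ω → ℝ := fun ω => pm p (fun ω => (X ω, Y ω)) (X ω, Y ω) with hq
  set r : Ω → ℝ := fun ω => pm p Z (Z ω) with hr
  have expand : ∀ ω, p ω * (pm p X (X ω) * pm p Y (Y ω) / (q ω * r ω)) =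
      ∑ a, ∑ b, if X a = X ω ∧ Y b = Y ω then p a * p b * (p ω / (q ω * r ω)) else 0 := by
    intro ω
    have : p ω * (pm p X (X ω) * pm p Y (Y ω) / (q ω * r ω)) =
      (pm p X (X ω) * pm p Y (Y ω)) * (p ω / (q ω * r ω)) := by ring
    rw [this, pm_eq_sum_ite, pm_eq_sum_ite, Finset.sum_mul_sum, Finset.sum_mul]
    refine Finset.sum_congr rfl fun a _ => ?_
    rw [Finset.sum_mul]
    refine Finset.sum_congr rfl fun b _ => ?_
    by_cases h1 : X a = X ω <;> by_cases h2 : Y b = Y ω <;> simp [h1, h2]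
  have inner : ∀ a b, (∑ ω, if X a = X ω ∧ Y b = Y ω
      then p a * p b * (p ω / (q ω * r ω)) else 0) ≤
      if Z b = Z a then p a / r a * p b else 0 := by
    intro a b
    have hra : 0 ≤ r a := pm_nonneg hp Z _
    by_cases hex : ∃ ω, X a = X ω ∧ Y b = Y ω
    · obtain ⟨ω₀, h1, h2⟩ := hex
      have hz : Z b = Z a := (hY _ _ h2).trans (hX _ _ h1).symm
      rw [if_pos hz]
      have : (∑ ω, if X a = X ω ∧ Y b = Y ω then p a * p b * (p ω / (q ω * r ω)) else 0) =
          p a / r a * p b * (q ω₀ / q ω₀) := by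
        have hq0 : q ω₀ = ∑ ω, if (X ω, Y ω) = (X ω₀, Y ω₀) then p ω else 0 :=
          (pm_eq_sum_ite _ _ _).trans (Finset.sum_congr rfl fun _ _ => by congr)
        rw [div_eq_mul_inv (q ω₀)]
        nth_rewrite 1 [hq0]
        rw [Finset.sum_mul, Finset.mul_sum]
        refine Finset.sum_congr rfl fun ω _ => ?_
        by_cases hc : X a = X ω ∧ Y b = Y ω
        · have e1 : X ω = X ω₀ := hc.1.symm.trans h1
          have e2 : Y ω = Y ω₀ := hc.2.symm.trans h2
          have e3 : q ω = q ω₀ := by simp only [hq, e1, e2]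
          have e4 : r ω = r a := by simp only [hr, hX _ _ hc.1]
          rw [if_pos hc, if_pos (by rw [e1, e2]), e3, e4]
          rw [div_eq_mul_inv, div_eq_mul_inv, mul_inv]
          ring
        · rw [if_neg hc, if_neg]
          · ring
          · intro h
            rw [Prod.mk.injEq] at h
            exact hc ⟨h1.trans h.1.symm, h2.trans h.2.symm⟩
      rw [this]
      exact mul_le_of_le_one_right (mul_nonneg (div_nonneg (hp a) hra) (hp b)) (div_self_le_one _)
    · push Not at hex
      rw [Finset.sum_eq_zero]
      · split_ifs
        · exact mul_nonneg (div_nonneg (hp a) hra) (hp b)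
        · exact le_rfl
      · intro ω _
        rw [if_neg]
        exact fun h => hex ω h.1 h.2
  calc ∑ ω, p ω * (pm p X (X ω) * pm p Y (Y ω) / (q ω * r ω))
      = ∑ a, ∑ b, ∑ ω, if X a = X ω ∧ Y b = Y ω
          then p a * p b * (p ω / (q ω * r ω)) else 0 := by
        simp_rw [expand]
        rw [Finset.sum_comm]
        exact Finset.sum_congr rfl fun a _ => Finset.sum_comm
    _ ≤ ∑ a, ∑ b, if Z b = Z a then p a / r a * p b else 0 :=
        Finset.sum_le_sum fun a _ => Finset.sum_le_sum fun b _ => inner a b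
    _ = ∑ a, p a * (r a / r a) := by
        refine Finset.sum_congr rfl fun a _ => ?_
        have : r a = ∑ b, if Z b = Z a then p b else 0 := pm_eq_sum_ite _ _ _
        rw [mul_div_assoc', mul_comm (p a), mul_div_assoc, mul_comm]
        nth_rewrite 3 [this]
        rw [Finset.mul_sum]
        exact Finset.sum_congr rfl fun b _ => by split_ifs <;> simp
    _ ≤ ∑ a, p a :=
        Finset.sum_le_sum fun a _ => mul_le_of_le_one_right (hp a) (div_self_le_one _)
    _ = 1 := hs

/-- Submodularity of the Shannon entropy. -/
theorem H_prod_add_le (hp : ∀ ω, 0 ≤ p ω) (hs : ∑ ω, p ω = 1) {α β γ : Type*}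
    {X : Ω → α} {Y : Ω → β} {Z : Ω → γ}
    (hX : ∀ ω ω', X ω = X ω' → Z ω = Z ω') (hY : ∀ ω ω', Y ω = Y ω' → Z ω = Z ω') :
    H p (fun ω => (X ω, Y ω)) + H p Z ≤ H p X + H p Y := by
  have key := sum_mul_pm_ratio_le_one hp hs hX hY
  have hpt : ∀ ω, p ω - p ω * (pm p X (X ω) * pm p Y (Y ω) /
      (pm p (fun ω => (X ω, Y ω)) (X ω, Y ω) * pm p Z (Z ω))) ≤
      p ω * Real.log (pm p (fun ω => (X ω, Y ω)) (X ω, Y ω)) + p ω * Real.log (pm p Z (Z ω))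
        - p ω * Real.log (pm p X (X ω)) - p ω * Real.log (pm p Y (Y ω)) := by
    intro ω
    rcases (hp ω).eq_or_lt with h0 | h0
    · simp [← h0]
    · have x0 := h0.trans_le (le_pm hp X ω)
      have y0 := h0.trans_le (le_pm hp Y ω)
      have z0 := h0.trans_le (le_pm hp Z ω)
      have xy0 := h0.trans_le (le_pm hp (fun ω => (X ω, Y ω)) ω)
      have hlog := Real.log_le_sub_one_of_pos (div_pos (mul_pos x0 y0) (mul_pos xy0 z0))
      rw [Real.log_div (mul_pos x0 y0).ne' (mul_pos xy0 z0).ne', Real.log_mul x0.ne' y0.ne',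
        Real.log_mul xy0.ne' z0.ne'] at hlog
      nlinarith [mul_le_mul_of_nonneg_left hlog h0.le]
  have hsum := Finset.sum_le_sum fun ω (_ : ω ∈ Finset.univ) => hpt ω
  simp only [Finset.sum_sub_distrib, Finset.sum_add_distrib] at hsum
  simp only [H]
  linarith

end Entropy

namespace Code

variable (C : Code Ω V d)

/-- `C.Det L a`: the basic random variable described by `a` is determined by those in `L`. -/
def Det (L : List Atom) (a : Atom) : Prop :=
  ∀ ω ω', (∀ b ∈ L, C.atomRV b ω = C.atomRV b ω') → C.atomRV a ω = C.atomRV a ω'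

variable {C}

theorem Det.of_mem {L : List Atom} {a : Atom} (h : a ∈ L) : C.Det L a :=
  fun _ _ hb => hb a h

theorem Det.trans {L L' : List Atom} {a : Atom} (h : C.Det L' a) (hL : ∀ b ∈ L', C.Det L b) :
    C.Det L a :=
  fun ω ω' hb => h ω ω' fun b hb' => hL b hb' ω ω' hb

theorem Det.mono {L L' : List Atom} {a : Atom} (h : C.Det L' a) (hL : L' ⊆ L) : C.Det L a :=
  h.trans fun _ hb => .of_mem (hL hb)

theorem rv_eq_iff {L : List Atom} {ω ω' : Ω} :
    C.rv L ω = C.rv L ω' ↔ ∀ b ∈ L, C.atomRV b ω = C.atomRV b ω' :=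
  List.map_inj_left

theorem Det.of_isFuncOf {L : List Atom} {a : Atom} (h : IsFuncOf (C.atomRV a) (C.rv L)) :
    C.Det L a := by
  obtain ⟨f, hf⟩ := h
  intro ω ω' hb
  rw [hf, hf, rv_eq_iff.2 hb]

theorem HL_le_of_det {A B : List Atom} (h : ∀ a ∈ A, C.Det B a) : C.HL A ≤ C.HL B :=
  H_le_of_ker_le C.p_nonneg fun ω ω' hω => rv_eq_iff.2 fun a ha => h a ha ω ω' (rv_eq_iff.1 hω)

/-- Submodularity of the joint entropy of tuples of basic random variables. -/
theorem HL_add_le_of_det {A B D Z : List Atom} (hD : ∀ a ∈ D, C.Det (A ++ B) a)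
    (hA : ∀ a ∈ Z, C.Det A a) (hB : ∀ a ∈ Z, C.Det B a) :
    C.HL D + C.HL Z ≤ C.HL A + C.HL B := by
  refine le_trans (add_le_add_left (H_le_of_ker_le C.p_nonneg
    (Y := fun ω => (C.rv A ω, C.rv B ω)) fun ω ω' hω => ?_) _)
    (H_prod_add_le C.p_nonneg C.p_sum
      (fun ω ω' hω => rv_eq_iff.2 fun a ha => hA a ha ω ω' (rv_eq_iff.1 hω))
      (fun ω ω' hω => rv_eq_iff.2 fun a ha => hB a ha ω ω' (rv_eq_iff.1 hω)))
  rw [Prod.mk.injEq, rv_eq_iff, rv_eq_iff] at hω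
  refine rv_eq_iff.2 fun a ha => hD a ha ω ω' fun b hb => ?_
  rcases List.mem_append.1 hb with hb | hb
  · exact hω.1 b hb
  · exact hω.2 b hb

theorem HL_le_of_perm (hsym : C.Symmetrical) {A B : List Atom} (π : Equiv.Perm ℕ)
    (hπ : ∀ i ∈ Finset.Icc 1 (d + 1), π i ∈ Finset.Icc 1 (d + 1))
    (h : ∀ a ∈ A, C.Det B (a.perm π)) : C.HL A ≤ C.HL B := by
  rw [← hsym π hπ A]
  refine HL_le_of_det fun a ha => ?_
  obtain ⟨b, hb, rfl⟩ := List.mem_map.1 ha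
  exact h b hb

end Code

theorem mem_icc {a b x : ℕ} : x ∈ icc a b ↔ a ≤ x ∧ x ≤ b := by
  rw [icc, List.mem_range'_1]
  omega

theorem mem_U {t s : ℕ} {a : Atom} : a ∈ U d t s ↔
    (∃ i, 1 ≤ i ∧ i ≤ t ∧ a = .W i) ∨
      ∃ i j, t < j ∧ j ≤ s ∧ j < i ∧ i ≤ d + 1 ∧ a = .S i j := by
  simp only [U, Ws, SbarToL, SbarTo, Sto, List.mem_append, List.mem_map, List.mem_flatten, mem_icc]
  constructor
  · rintro (⟨i, h, rfl⟩ | ⟨_, ⟨j, h, rfl⟩, hi⟩)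
    · exact Or.inl ⟨i, h.1, h.2, rfl⟩
    · obtain ⟨i, h', rfl⟩ := List.mem_map.1 hi
      rw [mem_icc] at h'
      exact Or.inr ⟨i, j, h.1, h.2, h'.1, h'.2, rfl⟩
  · rintro (⟨i, h1, h2, rfl⟩ | ⟨i, j, h1, h2, h3, h4, rfl⟩)
    · exact Or.inl ⟨i, ⟨h1, h2⟩, rfl⟩
    · exact Or.inr ⟨_, ⟨j, ⟨h1, h2⟩, rfl⟩, List.mem_map.2 ⟨i, mem_icc.2 ⟨h3, h4⟩, rfl⟩⟩

theorem W_mem_U {t s i : ℕ} (h1 : 1 ≤ i) (h2 : i ≤ t) : Atom.W i ∈ U d t s :=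
  mem_U.2 (Or.inl ⟨i, h1, h2, rfl⟩)

theorem S_mem_U {t s i j : ℕ} (h1 : t < j) (h2 : j ≤ s) (h3 : j < i) (h4 : i ≤ d + 1) :
    Atom.S i j ∈ U d t s :=
  mem_U.2 (Or.inr ⟨i, j, h1, h2, h3, h4, rfl⟩)

theorem mem_MsL_icc {a b : ℕ} {x : Atom} :
    x ∈ MsL (icc a b) ↔ ∃ j, a ≤ j ∧ j ≤ b ∧ x = .M j := by
  simp only [MsL, List.mem_map, mem_icc, and_assoc, eq_comm]

theorem mem_Mup {m : ℕ} {x : Atom} : x ∈ Mup m ↔ ∃ j, 1 ≤ j ∧ j ≤ m ∧ x = .M j :=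
  mem_MsL_icc

theorem mem_Sto_icc {a b j : ℕ} {x : Atom} :
    x ∈ Sto (icc a b) j ↔ ∃ i, a ≤ i ∧ i ≤ b ∧ x = .S i j := by
  simp only [Sto, List.mem_map, mem_icc, and_assoc, eq_comm]

theorem mem_StoFull {j : ℕ} {x : Atom} :
    x ∈ StoFull d j ↔ ∃ i, 1 ≤ i ∧ i ≤ d + 1 ∧ i ≠ j ∧ x = .S i j := by
  simp only [StoFull, Sto, List.mem_map, List.mem_filter, mem_icc, decide_eq_true_eq, and_assoc,
    eq_comm (b := x)]

theorem mem_StoFullL {A : List ℕ} {x : Atom} :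
    x ∈ StoFullL d A ↔ ∃ j ∈ A, ∃ i, 1 ≤ i ∧ i ≤ d + 1 ∧ i ≠ j ∧ x = .S i j := by
  simp only [StoFullL, List.mem_flatten, List.mem_map]
  constructor
  · rintro ⟨_, ⟨j, hj, rfl⟩, hx⟩
    exact ⟨j, hj, mem_StoFull.1 hx⟩
  · rintro ⟨j, hj, hx⟩
    exact ⟨_, ⟨j, hj, rfl⟩, mem_StoFull.2 hx⟩

namespace Code

variable {C : Code Ω V d}

theorem Det.S_of_W {L : List Atom} {i j : ℕ} (h : C.Det L (.W i)) (hi : 1 ≤ i) (hi' : i ≤ d + 1)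
    (hj : 1 ≤ j) (hj' : j ≤ d + 1) (hij : i ≠ j) : C.Det L (.S i j) := by
  obtain ⟨f, hf⟩ := C.S_func i (Finset.mem_Icc.2 ⟨hi, hi'⟩) j (Finset.mem_Icc.2 ⟨hj, hj'⟩) hij
  intro ω ω' hb
  have := h ω ω' hb
  simp only [atomRV] at this ⊢
  rw [hf, hf, this]

/-- By node regeneration, `U^{(t,s)}` determines the first `s` nodes. -/
theorem det_U_W (hregen : C.NodeRegen) {t s : ℕ} :
    ∀ i, 1 ≤ i → (i ≤ t ∨ i ≤ s) → i ≤ d + 1 → C.Det (U d t s) (.W i) := by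
  intro i
  induction i using Nat.strong_induction_on with
  | _ i ih =>
    intro h1 h2 h3
    by_cases hit : i ≤ t
    · exact .of_mem (W_mem_U h1 hit)
    · refine Det.trans (.of_isFuncOf (hregen i (Finset.mem_Icc.2 ⟨h1, h3⟩))) fun b hb => ?_
      obtain ⟨k, hk1, hk2, hki, rfl⟩ := mem_StoFull.1 hb
      rcases lt_or_gt_of_ne hki with hlt | hgt
      · exact (ih k hlt hk1 (by omega) hk2).S_of_W hk1 hk2 h1 h3 hki
      · exact .of_mem (S_mem_U (by omega) (by omega) hgt hk2)

theorem det_Ws_M {ℓ : ℕ} (hrec : C.MsgRecovery ℓ) {j : ℕ} (h1 : 1 ≤ j) (hj : j ≤ d)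
    {L : List Atom} (hL : ∀ i, 1 ≤ i → i ≤ j → C.Det L (.W i)) : C.Det L (.M j) := by
  by_cases hjl : j ≤ ℓ
  · obtain ⟨c, hc⟩ := hrec.1 j (Finset.mem_Icc.2 ⟨h1, hjl⟩)
    intro ω ω' _
    simp [atomRV, hc]
  · have := hrec.2 (Finset.Icc 1 j) (Finset.Icc_subset_Icc le_rfl (by omega))
      (by simp; omega)
    rw [Nat.card_Icc, Nat.add_sub_cancel] at this
    refine Det.trans (.of_isFuncOf this) fun b hb => ?_
    simp only [Ws, List.mem_map, Finset.mem_sort, Finset.mem_Icc] at hb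
    obtain ⟨i, hi, rfl⟩ := hb
    exact hL i hi.1 hi.2

theorem det_U_Mup (hregen : C.NodeRegen) {ℓ : ℕ} (hrec : C.MsgRecovery ℓ) {t s r : ℕ}
    (hs : s ≤ d) (hr : r ≤ s) : ∀ a ∈ Mup r, C.Det (U d t s) a := by
  intro a ha
  obtain ⟨j, h1, h2, rfl⟩ := mem_Mup.1 ha
  exact det_Ws_M hrec h1 (by omega) fun i hi hi' =>
    det_U_W hregen i hi (by omega) (by omega)

theorem HL_U_append_Mup (hregen : C.NodeRegen) {ℓ : ℕ} (hrec : C.MsgRecovery ℓ) {t s r : ℕ}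
    (hs : s ≤ d) (hr : r ≤ s) : C.HL (U d t s ++ Mup r) = C.HL (U d t s) := by
  apply le_antisymm
  · refine HL_le_of_det fun a ha => ?_
    rcases List.mem_append.1 ha with ha | ha
    · exact .of_mem ha
    · exact det_U_Mup hregen hrec hs hr a ha
  · exact HL_le_of_det fun a ha => .of_mem (List.mem_append_left _ ha)

theorem HL_M_eq_zero {ℓ j : ℕ} (hrec : C.MsgRecovery ℓ) (h1 : 1 ≤ j) (hj : j ≤ ℓ) :
    C.HL [Atom.M j] = 0 := by
  obtain ⟨c, hc⟩ := hrec.1 j (Finset.mem_Icc.2 ⟨h1, hj⟩)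
  simp [HL, H, pm, rv, atomRV, hc, C.p_sum]

theorem HL_nil : C.HL [] = 0 := by
  simp [HL, H, pm, rv, C.p_sum]

theorem HL_append_le (A B : List Atom) : C.HL (A ++ B) ≤ C.HL A + C.HL B := by
  have := HL_add_le_of_det (C := C) (A := A) (B := B) (D := A ++ B) (Z := [])
    (fun a ha => .of_mem ha) (by simp) (by simp)
  rwa [HL_nil, add_zero] at this

theorem HL_M (j : ℕ) : C.HL [Atom.M j] = H C.p (C.M j) :=
  le_antisymm
    (H_le_of_ker_le C.p_nonneg fun ω ω' h => rv_eq_iff.2 (by simpa [atomRV] using h))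
    (H_le_of_ker_le C.p_nonneg fun ω ω' h => by simpa [atomRV] using rv_eq_iff.1 h)

theorem HL_Mup_top : C.HL (Mup d) = ∑ j ∈ Finset.Icc 1 d, C.HL [Atom.M j] := by
  have h1 : C.HL (Mup d) = H C.p (fun ω (i : Fin d) => C.M (↑i + 1) ω) := by
    apply le_antisymm
    · refine H_le_of_ker_le C.p_nonneg fun ω ω' h => rv_eq_iff.2 fun b hb => ?_
      obtain ⟨j, hj, hj', rfl⟩ := mem_Mup.1 hb
      have := congrFun h ⟨j - 1, by omega⟩
      simpa [atomRV, Nat.sub_add_cancel hj] using this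
    · refine H_le_of_ker_le C.p_nonneg fun ω ω' h => funext fun i => ?_
      exact rv_eq_iff.1 h (.M (i + 1)) (mem_Mup.2 ⟨_, by omega, by omega, rfl⟩)
  simp only [h1, HL_M, H, Finset.sum_neg_distrib]
  rw [Finset.sum_comm]
  congr 1
  refine Finset.sum_congr rfl fun ω _ => ?_
  rw [C.M_indep fun j => C.M j ω, ← Finset.mul_sum]
  rcases (C.p_nonneg ω).eq_or_lt with h0 | h0
  · simp [← h0]
  · rw [Real.log_prod fun j _ => (h0.trans_le (le_pm C.p_nonneg (C.M j) ω)).ne']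

theorem HL_Mup_succ_le (m : ℕ) : C.HL (Mup (m + 1)) ≤ C.HL (Mup m) + C.HL [Atom.M (m + 1)] := by
  refine le_trans (HL_le_of_det fun a ha => .of_mem ?_) (HL_append_le _ _)
  obtain ⟨j, h1, h2, rfl⟩ := mem_Mup.1 ha
  rcases Nat.lt_or_ge m j with h | h
  · obtain rfl : j = m + 1 := by omega
    simp
  · exact List.mem_append_left _ (mem_Mup.2 ⟨j, h1, h, rfl⟩)

theorem HL_Mup {m : ℕ} (hm : m ≤ d) : C.HL (Mup m) = ∑ j ∈ Finset.Icc 1 m, C.HL [Atom.M j] := by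
  have lower : ∀ k, m ≤ k → C.HL (Mup k) - ∑ j ∈ Finset.Icc 1 k, C.HL [Atom.M j] ≤
      C.HL (Mup m) - ∑ j ∈ Finset.Icc 1 m, C.HL [Atom.M j] := by
    intro k hk
    induction k, hk using Nat.le_induction with
    | base => exact le_rfl
    | succ k hk ih =>
      rw [Finset.sum_Icc_succ_top (by omega)]
      linarith [HL_Mup_succ_le (C := C) k]
  have upper : ∀ k, C.HL (Mup k) ≤ ∑ j ∈ Finset.Icc 1 k, C.HL [Atom.M j] := by
    intro k
    induction k with
    | zero => simp [Mup, MsL, icc, HL_nil]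
    | succ k ih =>
      rw [Finset.sum_Icc_succ_top (by omega)]
      linarith [HL_Mup_succ_le (C := C) k]
  have := lower d hm
  rw [HL_Mup_top, sub_self] at this
  linarith [upper m]

theorem HL_Mup_succ {m : ℕ} (hm : m + 1 ≤ d) :
    C.HL (Mup (m + 1)) = C.HL (Mup m) + C.HL [Atom.M (m + 1)] := by
  rw [HL_Mup hm, HL_Mup (by omega), Finset.sum_Icc_succ_top (by omega)]

/-- Repair secrecy makes `U^{(ℓ₁,ℓ₁+ℓ₂)}` independent of the messages. -/
theorem HL_U_add_HL_Mup_le {ℓ₁ ℓ₂ : ℕ} (hℓ : ℓ₁ + ℓ₂ < d) (hrec : C.MsgRecovery (ℓ₁ + ℓ₂))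
    (hsec : C.RepairSecrecy ℓ₁ ℓ₂) {m : ℕ} (hm : m ≤ d) :
    C.HL (U d ℓ₁ (ℓ₁ + ℓ₂)) + C.HL (Mup m) ≤ C.HL (U d ℓ₁ (ℓ₁ + ℓ₂) ++ Mup m) := by
  have hI := hsec (Finset.Icc 1 ℓ₁) (Finset.Icc (ℓ₁ + 1) (ℓ₁ + ℓ₂))
    (Finset.Icc_subset_Icc le_rfl (by omega)) (Finset.Icc_subset_Icc (by omega) (by omega))
    (Finset.disjoint_left.2 fun x hx hx' => by
      rw [Finset.mem_Icc] at hx hx'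
      omega)
    (by simp) (by simp)
  set Z := Ws ((Finset.Icc 1 ℓ₁).sort (· ≤ ·)) ++
    StoFullL d ((Finset.Icc (ℓ₁ + 1) (ℓ₁ + ℓ₂)).sort (· ≤ ·))
  have hUZ : ∀ a ∈ U d ℓ₁ (ℓ₁ + ℓ₂), C.Det Z a := by
    intro a ha
    refine .of_mem (List.mem_append.2 ?_)
    rcases mem_U.1 ha with ⟨i, h1, h2, rfl⟩ | ⟨i, j, h1, h2, h3, h4, rfl⟩
    · exact Or.inl (List.mem_map.2 ⟨i, by simp [h1, h2], rfl⟩)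
    · exact Or.inr (mem_StoFullL.2 ⟨j, by simp; omega, i, by omega, h4, by omega, rfl⟩)
  have hM : ∀ L : List Atom, (∀ j, ℓ₁ + ℓ₂ + 1 ≤ j → j ≤ d → C.Det L (.M j)) →
      ∀ a ∈ Mup d, C.Det L a := by
    intro L hL a ha
    obtain ⟨j, h1, h2, rfl⟩ := mem_Mup.1 ha
    by_cases hj : j ≤ ℓ₁ + ℓ₂
    · obtain ⟨c, hc⟩ := hrec.1 j (Finset.mem_Icc.2 ⟨h1, hj⟩)
      intro ω ω' _
      simp [atomRV, hc]
    · exact hL j (by omega) h2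
  have hMM : C.HL (Mup d) ≤ C.HL (MsL (icc (ℓ₁ + ℓ₂ + 1) d)) :=
    HL_le_of_det (hM _ fun j h1 h2 => .of_mem (mem_MsL_icc.2 ⟨j, h1, h2, rfl⟩))
  have h1 := HL_add_le_of_det (C := C) (A := Z) (B := U d ℓ₁ (ℓ₁ + ℓ₂) ++ Mup d)
    (D := MsL (icc (ℓ₁ + ℓ₂ + 1) d) ++ Z) (Z := U d ℓ₁ (ℓ₁ + ℓ₂)) (fun a ha => .of_mem (by
      rcases List.mem_append.1 ha with ha | ha
      · obtain ⟨j, h1, h2, rfl⟩ := mem_MsL_icc.1 ha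
        exact List.mem_append_right _ (List.mem_append_right _
          (mem_Mup.2 ⟨j, by omega, h2, rfl⟩))
      · exact List.mem_append_left _ ha))
    hUZ (fun a ha => .of_mem (List.mem_append_left _ ha))
  have h2 := HL_add_le_of_det (C := C) (A := U d ℓ₁ (ℓ₁ + ℓ₂) ++ Mup m) (B := Mup d)
    (D := U d ℓ₁ (ℓ₁ + ℓ₂) ++ Mup d) (Z := Mup m) (fun a ha => .of_mem (by
      simp only [List.mem_append] at ha ⊢
      tauto))
    (fun a ha => .of_mem (List.mem_append_right _ ha))
    (fun a ha => .of_mem (by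
      obtain ⟨j, h1, h2, rfl⟩ := mem_Mup.1 ha
      exact mem_Mup.2 ⟨j, h1, by omega, rfl⟩))
  rw [MI] at hI
  linarith

end Code

/-- The permutation cycling `a → a + 1 → ⋯ → b → a` and fixing everything else. -/
def cycleIcc (a b : ℕ) (hab : a ≤ b) : Equiv.Perm ℕ where
  toFun i := if a ≤ i ∧ i < b then i + 1 else if i = b then a else i
  invFun i := if a < i ∧ i ≤ b then i - 1 else if i = a then b else i
  left_inv i := by
    dsimp only
    split_ifs <;> omega
  right_inv i := by
    dsimp only
    split_ifs <;> omega

theorem cycleIcc_apply {a b : ℕ} (hab : a ≤ b) (i : ℕ) :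
    cycleIcc a b hab i = if a ≤ i ∧ i < b then i + 1 else if i = b then a else i :=
  rfl

namespace Code

variable {C : Code Ω V d}

theorem HL_S_append_U_le (hsym : C.Symmetrical) {t s k r : ℕ} (hts : t ≤ s)
    (hk : s + 2 + k ≤ d + 1) :
    C.HL (Atom.S (s + 2 + k) (s + 1) :: (U d t s ++ Mup r)) ≤
      C.HL (Atom.S (s + 2) (s + 1) :: (U d t s ++ Mup r)) := by
  refine HL_le_of_perm hsym (Equiv.swap (s + 2) (s + 2 + k)) (fun i hi => ?_) fun a ha => ?_
  · rw [Finset.mem_Icc] at hi ⊢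
    rw [Equiv.swap_apply_def]
    split_ifs <;> omega
  · rcases List.mem_cons.1 ha with rfl | ha
    · rw [Atom.perm, Equiv.swap_apply_right, Equiv.swap_apply_of_ne_of_ne (by omega) (by omega)]
      exact .of_mem List.mem_cons_self
    · refine .of_mem (List.mem_cons_of_mem _ (List.mem_append.2 ?_))
      rcases List.mem_append.1 ha with ha | ha
      · rcases mem_U.1 ha with ⟨i, h1, h2, rfl⟩ | ⟨i, j, h1, h2, h3, h4, rfl⟩
        · rw [Atom.perm, Equiv.swap_apply_of_ne_of_ne (by omega) (by omega)]
          exact Or.inl (W_mem_U h1 h2)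
        · rw [Atom.perm, Equiv.swap_apply_of_ne_of_ne (x := j) (by omega) (by omega)]
          refine Or.inl (S_mem_U h1 h2 ?_ ?_) <;>
          · rw [Equiv.swap_apply_def]
            split_ifs <;> omega
      · obtain ⟨j, h1, h2, rfl⟩ := mem_Mup.1 ha
        exact Or.inr (mem_Mup.2 ⟨j, h1, h2, rfl⟩)

theorem HL_Sto_append_U_le (hsym : C.Symmetrical) {t s r : ℕ} (hts : t ≤ s) :
    ∀ k, s + 2 + k ≤ d + 1 →
      C.HL (Sto (icc (s + 2) (s + 2 + k)) (s + 1) ++ (U d t s ++ Mup r)) ≤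
      C.HL (Atom.S (s + 2) (s + 1) :: (U d t s ++ Mup r)) +
        k * (C.HL (Atom.S (s + 2) (s + 1) :: (U d t s ++ Mup r)) - C.HL (U d t s ++ Mup r)) := by
  intro k hk
  induction k with
  | zero => simp [icc, Sto]
  | succ k ih =>
    have h := HL_add_le_of_det (C := C)
      (A := Sto (icc (s + 2) (s + 2 + k)) (s + 1) ++ (U d t s ++ Mup r))
      (B := Atom.S (s + 2 + (k + 1)) (s + 1) :: (U d t s ++ Mup r))
      (D := Sto (icc (s + 2) (s + 2 + (k + 1))) (s + 1) ++ (U d t s ++ Mup r))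
      (Z := U d t s ++ Mup r) (fun a ha => .of_mem (by
        rcases List.mem_append.1 ha with ha | ha
        · obtain ⟨i, h1, h2, rfl⟩ := mem_Sto_icc.1 ha
          rcases Nat.lt_or_ge (s + 2 + k) i with h | h
          · obtain rfl : i = s + 2 + (k + 1) := by omega
            simp
          · exact List.mem_append_left _ (List.mem_append_left _ (mem_Sto_icc.2 ⟨i, h1, h, rfl⟩))
        · exact List.mem_append_left _ (List.mem_append_right _ ha)))
      (fun a ha => .of_mem (List.mem_append_right _ ha))
      (fun a ha => .of_mem (List.mem_cons_of_mem _ ha))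
    have h' := HL_S_append_U_le hsym (r := r) hts hk
    push_cast
    linarith [ih (by omega)]

theorem HL_Sto_append_U_eq {t s r : ℕ} (hts : t ≤ s) :
    C.HL (Sto (icc (s + 2) (d + 1)) (s + 1) ++ (U d t s ++ Mup r)) =
      C.HL (U d t (s + 1) ++ Mup r) := by
  apply le_antisymm
  · refine HL_le_of_det fun a ha => .of_mem ?_
    rcases List.mem_append.1 ha with ha | ha
    · obtain ⟨i, h1, h2, rfl⟩ := mem_Sto_icc.1 ha
      exact List.mem_append_left _ (S_mem_U (by omega) le_rfl (by omega) h2)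
    · rcases List.mem_append.1 ha with ha | ha
      · rcases mem_U.1 ha with ⟨i, h1, h2, rfl⟩ | ⟨i, j, h1, h2, h3, h4, rfl⟩
        · exact List.mem_append_left _ (W_mem_U h1 h2)
        · exact List.mem_append_left _ (S_mem_U h1 (by omega) h3 h4)
      · exact List.mem_append_right _ ha
  · refine HL_le_of_det fun a ha => .of_mem ?_
    rcases List.mem_append.1 ha with ha | ha
    · rcases mem_U.1 ha with ⟨i, h1, h2, rfl⟩ | ⟨i, j, h1, h2, h3, h4, rfl⟩
      · exact List.mem_append_right _ (List.mem_append_left _ (W_mem_U h1 h2))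
      · rcases Nat.lt_or_ge s j with h | h
        · obtain rfl : j = s + 1 := by omega
          exact List.mem_append_left _ (mem_Sto_icc.2 ⟨i, by omega, h4, rfl⟩)
        · exact List.mem_append_right _ (List.mem_append_left _ (S_mem_U h1 h h3 h4))
    · exact List.mem_append_right _ (List.mem_append_right _ ha)

theorem HL_U_succ_sub_le_Sto (hsym : C.Symmetrical) {t s r : ℕ} (hts : t ≤ s) (hs : s + 1 ≤ d) :
    C.HL (U d (t + 1) (s + 2) ++ Mup r) - C.HL (U d (t + 1) (s + 1) ++ Mup r) ≤
      C.HL (Sto (icc (s + 2) (d + 1)) (s + 1) ++ (U d t s ++ Mup r)) -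
        C.HL (Atom.S (s + 2) (s + 1) :: (U d t s ++ Mup r)) := by
  set π := cycleIcc (t + 1) (s + 2) (by omega) with hπ
  have hmaps : ∀ i ∈ Finset.Icc 1 (d + 1), π i ∈ Finset.Icc 1 (d + 1) := by
    intro i hi
    rw [Finset.mem_Icc] at hi ⊢
    rw [hπ, cycleIcc_apply]
    split_ifs <;> omega
  have hstep : ∀ i, t + 1 ≤ i → i ≤ s + 1 → π i = i + 1 := fun i h1 h2 => by
    rw [hπ, cycleIcc_apply, if_pos (by omega)]
  have hfix : ∀ i, i ≤ t ∨ s + 2 < i → π i = i := fun i h => by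
    rw [hπ, cycleIcc_apply, if_neg (by omega), if_neg (by omega)]
  have hlast : π (s + 2) = t + 1 := by
    rw [hπ, cycleIcc_apply, if_neg (by omega), if_pos rfl]
  have hS : ∀ j, 1 ≤ j → j ≤ d + 1 → j ≠ t + 1 →
      C.Det (U d (t + 1) (s + 1) ++ Mup r) (.S (t + 1) j) := fun j h1 h2 h3 =>
    Det.S_of_W (.of_mem (List.mem_append_left _ (W_mem_U (by omega) le_rfl)))
      (by omega) (by omega) h1 h2 h3.symm
  have h := HL_add_le_of_det (C := C)
    (A := (Sto (icc (s + 2) (d + 1)) (s + 1) ++ (U d t s ++ Mup r)).map (Atom.perm π))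
    (B := U d (t + 1) (s + 1) ++ Mup r) (D := U d (t + 1) (s + 2) ++ Mup r)
    (Z := (Atom.S (s + 2) (s + 1) :: (U d t s ++ Mup r)).map (Atom.perm π))
    (fun a ha => ?_) (fun a ha => .of_mem ?_) (fun a ha => ?_)
  · rw [hsym π hmaps, hsym π hmaps] at h
    linarith
  · rcases List.mem_append.1 ha with ha | ha
    · rcases mem_U.1 ha with ⟨i, h1, h2, rfl⟩ | ⟨i, j, h1, h2, h3, h4, rfl⟩
      · exact .of_mem (List.mem_append_right _ (List.mem_append_left _ (W_mem_U h1 h2)))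
      · rcases Nat.lt_or_ge (s + 1) j with h | h
        · obtain rfl : j = s + 2 := by omega
          refine .of_mem (List.mem_append_left _ (List.mem_map.2 ⟨.S i (s + 1), ?_, ?_⟩))
          · exact List.mem_append_left _ (mem_Sto_icc.2 ⟨i, by omega, h4, rfl⟩)
          · rw [Atom.perm, hfix i (by omega), hstep (s + 1) (by omega) le_rfl]
        · exact .of_mem (List.mem_append_right _ (List.mem_append_left _ (S_mem_U h1 h h3 h4)))
    · exact .of_mem (List.mem_append_right _ (List.mem_append_right _ ha))
  · obtain ⟨b, hb, rfl⟩ := List.mem_map.1 ha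
    refine List.mem_map.2 ⟨b, ?_, rfl⟩
    rcases List.mem_cons.1 hb with rfl | hb
    · exact List.mem_append_left _ (mem_Sto_icc.2 ⟨_, le_rfl, by omega, rfl⟩)
    · exact List.mem_append_right _ hb
  · obtain ⟨b, hb, rfl⟩ := List.mem_map.1 ha
    rcases List.mem_cons.1 hb with rfl | hb
    · rw [Atom.perm, hlast, hstep (s + 1) (by omega) le_rfl]
      exact hS _ (by omega) (by omega) (by omega)
    · rcases List.mem_append.1 hb with hb | hb
      · rcases mem_U.1 hb with ⟨i, h1, h2, rfl⟩ | ⟨i, j, h1, h2, h3, h4, rfl⟩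
        · rw [Atom.perm, hfix i (by omega)]
          exact .of_mem (List.mem_append_left _ (W_mem_U h1 (by omega)))
        · rw [Atom.perm, hstep j (by omega) (by omega)]
          by_cases hi : i = s + 2
          · rw [hi, hlast]
            exact hS _ (by omega) (by omega) (by omega)
          · refine .of_mem (List.mem_append_left _ (S_mem_U (by omega) (by omega) ?_ ?_)) <;>
            · rcases Nat.lt_or_ge (s + 2) i with h | h
              · rw [hfix i (by omega)]
                omega
              · rw [hstep i (by omega) (by omega)]
                omega
      · obtain ⟨j, h1, h2, rfl⟩ := mem_Mup.1 hb
        exact .of_mem (List.mem_append_right _ (mem_Mup.2 ⟨j, h1, h2, rfl⟩))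

/-- The exchange inequality: increments of the entropy of `U^{(t,s)}` in `s`, normalized by the
number of helpers involved, decrease even after one more repair is replaced by a node. -/
theorem exchange (hsym : C.Symmetrical) {t s r : ℕ} (hts : t ≤ s) (hs : s + 1 ≤ d) :
    ((d : ℝ) - s) *
        (C.HL (U d (t + 1) (s + 2) ++ Mup r) - C.HL (U d (t + 1) (s + 1) ++ Mup r)) ≤
      ((d : ℝ) - (s + 1)) * (C.HL (U d t (s + 1) ++ Mup r) - C.HL (U d t s ++ Mup r)) := by
  have h1 := HL_U_succ_sub_le_Sto hsym (r := r) hts hs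
  have h2 := HL_Sto_append_U_le hsym (r := r) hts (d - (s + 1)) (by omega)
  rw [show s + 2 + (d - (s + 1)) = d + 1 by omega, HL_Sto_append_U_eq hts,
    Nat.cast_sub hs, Nat.cast_add, Nat.cast_one] at h2
  rw [HL_Sto_append_U_eq hts] at h1
  have hsd : (s : ℝ) + 1 ≤ d := by exact_mod_cast hs
  have h3 := mul_le_mul_of_nonneg_left h1 (by linarith : (0 : ℝ) ≤ d - s)
  nlinarith

theorem HL_U_succ_sub_le (hregen : C.NodeRegen) {t s r : ℕ} (hts : t ≤ s) (hs : s + 1 ≤ d) :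
    C.HL (U d t (s + 2) ++ Mup r) - C.HL (U d t (s + 1) ++ Mup r) ≤
      C.HL (U d (t + 1) (s + 2) ++ Mup r) - C.HL (U d (t + 1) (s + 1) ++ Mup r) := by
  have h := HL_add_le_of_det (C := C) (A := U d (t + 1) (s + 2) ++ Mup r)
    (B := U d t (s + 1) ++ Mup r) (D := U d t (s + 2) ++ Mup r)
    (Z := U d (t + 1) (s + 1) ++ Mup r) (fun a ha => .of_mem ?_) (fun a ha => .of_mem ?_)
    (fun a ha => ?_)
  · linarith
  · rcases List.mem_append.1 ha with ha | ha
    · rcases mem_U.1 ha with ⟨i, h1, h2, rfl⟩ | ⟨i, j, h1, h2, h3, h4, rfl⟩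
      · exact List.mem_append_left _ (List.mem_append_left _ (W_mem_U h1 (by omega)))
      · rcases Nat.lt_or_ge (s + 1) j with h | h
        · exact List.mem_append_left _ (List.mem_append_left _ (S_mem_U (by omega) h2 h3 h4))
        · exact List.mem_append_right _ (List.mem_append_left _ (S_mem_U h1 h h3 h4))
    · exact List.mem_append_right _ (List.mem_append_right _ ha)
  · rcases List.mem_append.1 ha with ha | ha
    · rcases mem_U.1 ha with ⟨i, h1, h2, rfl⟩ | ⟨i, j, h1, h2, h3, h4, rfl⟩
      · exact List.mem_append_left _ (W_mem_U h1 h2)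
      · exact List.mem_append_left _ (S_mem_U h1 (by omega) h3 h4)
    · exact List.mem_append_right _ ha
  · rcases List.mem_append.1 ha with ha | ha
    · refine Det.mono (L' := U d t (s + 1)) ?_ (List.subset_append_left _ _)
      rcases mem_U.1 ha with ⟨i, h1, h2, rfl⟩ | ⟨i, j, h1, h2, h3, h4, rfl⟩
      · exact det_U_W hregen i h1 (by omega) (by omega)
      · exact .of_mem (S_mem_U (by omega) h2 h3 h4)
    · exact .of_mem (List.mem_append_right _ ha)

end Code

theorem T_self (d ℓ : ℕ) : T d ℓ ℓ = 0 := by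
  simp [T]

theorem T_succ {d k ℓ : ℕ} (h : ℓ ≤ k) : T d (k + 1) ℓ = T d k ℓ + ((d : ℝ) - k) := by
  rw [T, Finset.sum_Icc_succ_top (by omega), T]
  push_cast
  ring

theorem T_eq_add_T_succ {d k ℓ : ℕ} (h : ℓ < k) : T d k ℓ = ((d : ℝ) - ℓ) + T d k (ℓ + 1) := by
  induction k, h using Nat.le_induction with
  | base => rw [T_succ le_rfl, T_self, T_self, zero_add, add_zero]
  | succ k hk ih => rw [T_succ (by omega), T_succ hk, ih, add_assoc]

theorem T_mono {d k k' ℓ : ℕ} (h : k ≤ k') (hk : ℓ ≤ k) (hd : k' ≤ d) : T d k ℓ ≤ T d k' ℓ := by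
  induction k', h using Nat.le_induction with
  | base => exact le_rfl
  | succ k' hk' ih =>
    rw [T_succ (by omega)]
    have : (k' : ℝ) + 1 ≤ d := by exact_mod_cast hd
    linarith [ih (by omega)]

theorem T_pos {d k ℓ : ℕ} (h : ℓ < k) (hd : k ≤ d) : 0 < T d k ℓ := by
  refine lt_of_lt_of_le ?_ (T_mono (Nat.succ_le_of_lt h) (by omega) hd)
  have : (ℓ : ℝ) + 1 ≤ d := by exact_mod_cast (by omega : ℓ + 1 ≤ d)
  rw [T_succ le_rfl, T_self]
  linarith

/-- If the slopes `(g (s + 1) - g s) / (d - s)` decrease from `ℓ` on, the last one is at most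
the average slope. -/
theorem T_mul_increment_le {d ℓ : ℕ} {g : ℕ → ℝ}
    (hg : ∀ s, ℓ ≤ s → s + 1 < d →
      ((d : ℝ) - s) * (g (s + 2) - g (s + 1)) ≤ ((d : ℝ) - (s + 1)) * (g (s + 1) - g s))
    (s : ℕ) (hℓ : ℓ ≤ s) (hs : s < d) :
    T d (s + 1) ℓ * (g (s + 1) - g s) ≤ ((d : ℝ) - s) * (g (s + 1) - g ℓ) := by
  induction s, hℓ using Nat.le_induction with
  | base => rw [T_succ le_rfl, T_self, zero_add]
  | succ s hℓ ih =>
    have h1 := ih (by omega)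
    have h2 := hg s hℓ hs
    have hd : (s : ℝ) + 1 < d := by exact_mod_cast hs
    have hT := T_pos (d := d) (Nat.lt_succ_of_le hℓ) (by omega)
    rw [T_succ (by omega)]
    push_cast
    have h3 : ((d : ℝ) - s) * (T d (s + 1) ℓ * (g (s + 1 + 1) - g (s + 1))) ≤
        ((d : ℝ) - s) * (((d : ℝ) - (s + 1)) * (g (s + 1) - g ℓ)) := by
      have h4 := mul_le_mul_of_nonneg_left h2 hT.le
      have h5 := mul_le_mul_of_nonneg_left h1 (by linarith : (0 : ℝ) ≤ d - (s + 1))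
      linarith
    have h6 := le_of_mul_le_mul_left h3 (by linarith)
    linarith

namespace Code

variable {C : Code Ω V d}

/-- One step of the converse: trading the weight at level `m` for that at level `m + 1`. -/
theorem weighted_HL_U_step (hsym : C.Symmetrical) (hregen : C.NodeRegen) {t ℓ m r : ℕ}
    (htℓ : t ≤ ℓ) (hm : ℓ < m) (hmd : m < d) :
    C.HL (U d (t + 1) (m + 1) ++ Mup r) +
        (T d d ℓ / T d (m + 1) ℓ - 1) * C.HL (U d t (m + 1) ++ Mup r) +
        (T d d ℓ / T d m ℓ - T d d ℓ / T d (m + 1) ℓ) * C.HL (U d t ℓ ++ Mup r) ≤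
      C.HL (U d (t + 1) m ++ Mup r) +
        (T d d ℓ / T d m ℓ - 1) * C.HL (U d t m ++ Mup r) := by
  obtain ⟨s, rfl⟩ : ∃ s, m = s + 1 := ⟨m - 1, by omega⟩
  have hd : (s : ℝ) + 1 < d := by exact_mod_cast hmd
  have h1 := exchange hsym (r := r) (htℓ.trans (Nat.le_of_lt_succ hm)) hmd.le
  have h2 := HL_U_succ_sub_le hregen (r := r) (htℓ.trans (Nat.le_of_lt_succ hm)) hmd.le
  have h3 := T_mul_increment_le (d := d) (g := fun s => C.HL (U d t s ++ Mup r))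
    (fun s hs hsd => (mul_le_mul_of_nonneg_left
      (HL_U_succ_sub_le hregen (r := r) (htℓ.trans hs) hsd.le)
      (by
        have : (s : ℝ) + 1 < d := by exact_mod_cast hsd
        linarith)).trans (exchange hsym (htℓ.trans hs) hsd.le)) s (Nat.le_of_lt_succ hm) (by omega)
  have hT := T_pos (d := d) hm hmd.le
  have hT' : T d (s + 1 + 1) ℓ = T d (s + 1) ℓ + (d - (s + 1)) := by
    rw [T_succ (by omega)]
    push_cast
    ring
  have hTpos' := T_pos (d := d) (k := s + 1 + 1) (ℓ := ℓ) (by omega) hmd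
  have hTd : 1 ≤ T d d ℓ / T d (s + 1 + 1) ℓ := by
    rw [one_le_div hTpos']
    exact T_mono hmd (by omega) le_rfl
  have hαβ : T d d ℓ / T d (s + 1) ℓ =
      T d d ℓ / T d (s + 1 + 1) ℓ * (1 + (d - (s + 1)) / T d (s + 1) ℓ) := by
    have e : 1 + (d - (s + 1)) / T d (s + 1) ℓ = T d (s + 1 + 1) ℓ / T d (s + 1) ℓ := by
      rw [hT']
      field_simp
    rw [e]
    field_simp
  rw [hαβ]
  set β := T d d ℓ / T d (s + 1 + 1) ℓ
  set g₀ := C.HL (U d t (s + 1) ++ Mup r)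
  set g₁ := C.HL (U d (t + 1) (s + 1) ++ Mup r)
  set gℓ := C.HL (U d t ℓ ++ Mup r)
  have hD : C.HL (U d (t + 1) (s + 2) ++ Mup r) - g₁ ≤
      (d - (s + 1)) / T d (s + 1) ℓ * (g₀ - gℓ) := by
    rw [div_mul_eq_mul_div, le_div_iff₀ hT]
    have h4 : ((d : ℝ) - s) * ((C.HL (U d (t + 1) (s + 2) ++ Mup r) - g₁) * T d (s + 1) ℓ) ≤
        ((d : ℝ) - s) * ((d - (s + 1)) * (g₀ - gℓ)) := by
      have h5 := mul_le_mul_of_nonneg_left h1 hT.le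
      have h6 := mul_le_mul_of_nonneg_left h3 (by linarith : (0 : ℝ) ≤ d - (s + 1))
      linarith
    exact le_of_mul_le_mul_left h4 (by linarith)
  have hD' := mul_le_mul_of_nonneg_left (h2.trans hD) (sub_nonneg.2 hTd)
  change C.HL (U d (t + 1) (s + 2) ++ Mup r) + (β - 1) * C.HL (U d t (s + 2) ++ Mup r) + _ ≤ _
  linarith

theorem HL_U_le_HL_U_succ_top (hregen : C.NodeRegen) {t ℓ r : ℕ} (hℓ : ℓ ≤ d) (ht : t ≤ ℓ) :
    C.HL (U d t ℓ ++ Mup r) ≤ C.HL (U d (t + 1) d ++ Mup r) := by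
  have hW : ∀ i, 1 ≤ i → i ≤ d → C.Det (U d (t + 1) d ++ Mup r) (.W i) := fun i h1 h2 =>
    (det_U_W hregen i h1 (by omega) (by omega)).mono (List.subset_append_left _ _)
  have hW' : C.Det (U d (t + 1) d ++ Mup r) (.W (d + 1)) := by
    refine Det.trans (.of_isFuncOf (hregen (d + 1) (by simp))) fun b hb => ?_
    obtain ⟨k, hk1, hk2, hki, rfl⟩ := mem_StoFull.1 hb
    exact (hW k hk1 (by omega)).S_of_W hk1 hk2 (by omega) le_rfl hki
  refine HL_le_of_det fun a ha => ?_
  rcases List.mem_append.1 ha with ha | ha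
  · rcases mem_U.1 ha with ⟨i, h1, h2, rfl⟩ | ⟨i, j, h1, h2, h3, h4, rfl⟩
    · exact hW i h1 (by omega)
    · have : C.Det (U d (t + 1) d ++ Mup r) (.W i) := by
        rcases Nat.lt_or_ge d i with h | h
        · obtain rfl : i = d + 1 := by omega
          exact hW'
        · exact hW i (by omega) h
      exact this.S_of_W (by omega) h4 (by omega) (by omega) (by omega)
  · exact .of_mem (List.mem_append_right _ ha)

end Code

theorem statement14 {Ω V : Type} [Fintype Ω] {d : ℕ} (hd : 2 ≤ d)
    {ℓ₁ ℓ₂ ℓ : ℕ} (hℓdef : ℓ = ℓ₁ + ℓ₂) (hℓd : ℓ < d)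
    (C : Code Ω V d) (hsym : C.Symmetrical) (hregen : C.NodeRegen)
    (hrec : C.MsgRecovery ℓ) (hsec : C.RepairSecrecy ℓ₁ ℓ₂) :
    C.HL (U d (ℓ₁ + 1) (ℓ + 1)) + T d d (ℓ + 1) / ((d : ℝ) - (ℓ : ℝ)) * C.HL (U d ℓ₁ (ℓ + 1))
      ≥ T d d ℓ * (∑ j ∈ Finset.Icc (ℓ + 1) d, (T d j ℓ)⁻¹ * C.HL [Atom.M j])
        + T d d ℓ / ((d : ℝ) - (ℓ : ℝ)) * C.HL (U d ℓ₁ ℓ) := by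
  subst hℓdef
  set ℓ := ℓ₁ + ℓ₂
  set u := C.HL (U d ℓ₁ ℓ)
  have hdℓ : (0 : ℝ) < d - ℓ := sub_pos.2 (by exact_mod_cast hℓd)
  have hT₁ : T d (ℓ + 1) ℓ = d - ℓ := by rw [T_succ le_rfl, T_self, zero_add]
  have hMup₀ : C.HL (Mup ℓ) = 0 := by
    rw [Code.HL_Mup hℓd.le]
    refine Finset.sum_eq_zero fun j hj => ?_
    rw [Finset.mem_Icc] at hj
    exact Code.HL_M_eq_zero hrec hj.1 hj.2
  have hcoef : T d d (ℓ + 1) / (d - ℓ) = T d d ℓ / T d (ℓ + 1) ℓ - 1 := by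
    rw [hT₁, T_eq_add_T_succ hℓd]
    field_simp
    ring
  have hsec' : ∀ m ≤ d, u + C.HL (Mup m) ≤ C.HL (U d ℓ₁ ℓ ++ Mup m) := fun m hm =>
    Code.HL_U_add_HL_Mup_le hℓd hrec hsec hm
  have key : ∀ m, ℓ + 1 ≤ m → m ≤ d →
      C.HL (U d (ℓ₁ + 1) m) + (T d d ℓ / T d m ℓ - 1) * C.HL (U d ℓ₁ m)
        - T d d ℓ / T d m ℓ * C.HL (Mup m)
        + T d d ℓ * (∑ j ∈ Finset.Icc (ℓ + 1) m, (T d j ℓ)⁻¹ * C.HL [Atom.M j])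
        + (T d d ℓ / T d (ℓ + 1) ℓ - T d d ℓ / T d m ℓ) * u ≤
      C.HL (U d (ℓ₁ + 1) (ℓ + 1)) +
        (T d d ℓ / T d (ℓ + 1) ℓ - 1) * C.HL (U d ℓ₁ (ℓ + 1)) := by
    intro m hm hmd
    induction m, hm using Nat.le_induction with
    | base =>
      rw [Code.HL_Mup_succ hℓd, hMup₀, Finset.Icc_self, Finset.sum_singleton, div_eq_mul_inv]
      linarith
    | succ m hm ih =>
      have hstep := Code.weighted_HL_U_step hsym hregen (r := m) (t := ℓ₁) (ℓ := ℓ) (by omega)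
        hm hmd
      rw [Code.HL_U_append_Mup hregen hrec hmd (by omega),
        Code.HL_U_append_Mup hregen hrec hmd (by omega),
        Code.HL_U_append_Mup hregen hrec (by omega) le_rfl,
        Code.HL_U_append_Mup hregen hrec (by omega) le_rfl] at hstep
      have hle : 0 ≤ T d d ℓ / T d m ℓ - T d d ℓ / T d (m + 1) ℓ :=
        sub_nonneg.2 (div_le_div_of_nonneg_left (T_pos hℓd le_rfl).le (T_pos hm (by omega))
          (T_mono (Nat.le_succ m) (by omega) hmd))
      have hu' := mul_le_mul_of_nonneg_left (hsec' m (by omega)) hle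
      specialize ih (by omega)
      rw [Finset.sum_Icc_succ_top (by omega), Code.HL_Mup_succ hmd]
      have e : T d d ℓ * ((T d (m + 1) ℓ)⁻¹ * C.HL [Atom.M (m + 1)]) =
          T d d ℓ / T d (m + 1) ℓ * C.HL [Atom.M (m + 1)] := by
        rw [div_eq_mul_inv, mul_assoc]
      rw [mul_add (T d d ℓ), e]
      linarith
  have hfin := key d hℓd le_rfl
  have hend := (hsec' d le_rfl).trans
    (Code.HL_U_le_HL_U_succ_top hregen (r := d) hℓd.le (Nat.le_add_right ℓ₁ ℓ₂))
  rw [Code.HL_U_append_Mup hregen hrec le_rfl le_rfl] at hend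
  rw [div_self (T_pos hℓd le_rfl).ne'] at hfin
  rw [hcoef, ← hT₁]
  linarith

end

end MDCSR
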